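/- Let n ≥ 2, let I ∈ J(A_n), let 1 ≤ i,j ≤ n−1, and let p ∈ S_{i,j} with t_p(I) ≠ I. Let h and h' be the height function matrices corresponding to I and to t_p(I) respectively under the bijection h_{a,b} = min(a+b, 2n−a−b) − 2·|I ∩ S_{a,b}|. Then h' agrees with h in every entry except (i,j), and h'_{i,j} = h_{i,j} + 2 if p ∈ I (p is toggled out of I), while h'_{i,j} = h_{i,j} − 2 if p ∉ I (p is toggled into I). -/

import Mathlib

open scoped Classical

/-- Membership in the underlying set of the alternating sign matrix poset `A_n`:
triples `(i,j,k) ∈ ℤ³` with `i, j, k ≥ 0` and `i + j + k ≤ n - 2`. -/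
def AMem (n : ℕ) (x : ℤ × ℤ × ℤ) : Prop :=
  0 ≤ x.1 ∧ 0 ≤ x.2.1 ∧ 0 ≤ x.2.2 ∧ x.1 + x.2.1 + x.2.2 ≤ (n : ℤ) - 2

/-- The generating covering relation of `A_n`: `ACovRel n q p` holds when `p = (i,j,k)`
covers `q`, i.e. `q` is one of `(i,j+1,k)`, `(i,j+1,k-1)`, `(i+1,j,k)`, `(i+1,j,k-1)`
and both lie in the underlying set. -/
def ACovRel (n : ℕ) (q p : ℤ × ℤ × ℤ) : Prop :=
  AMem n q ∧ AMem n p ∧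
    (q = (p.1, p.2.1 + 1, p.2.2) ∨ q = (p.1, p.2.1 + 1, p.2.2 - 1) ∨
      q = (p.1 + 1, p.2.1, p.2.2) ∨ q = (p.1 + 1, p.2.1, p.2.2 - 1))

/-- The partial order of `A_n`: the reflexive-transitive closure of the covering
relations. -/
def Ale (n : ℕ) (q p : ℤ × ℤ × ℤ) : Prop := Relation.ReflTransGen (ACovRel n) q p

/-- The strict order of `A_n`. -/
def Alt (n : ℕ) (q p : ℤ × ℤ × ℤ) : Prop := Ale n q p ∧ q ≠ p

/-- `ACovBy n q p`: `p` covers `q` in the partial order of `A_n`, i.e. `q < p` and there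
is no `r` with `q < r < p`. -/
def ACovBy (n : ℕ) (q p : ℤ × ℤ × ℤ) : Prop :=
  Alt n q p ∧ ∀ r, Alt n q r → ¬ Alt n r p

/-- The rank function `r(i,j,k) = n - 2 - i - j` on `A_n`. -/
def Arank (n : ℕ) (x : ℤ × ℤ × ℤ) : ℤ := (n : ℤ) - 2 - x.1 - x.2.1


/-- The chain `S_{i,j} = { (i-1-t, j-1-t, t) : t ∈ ℤ, t ≥ 0 } ∩ A_n`. -/
def Sij (n : ℕ) (i j : ℤ) : Set (ℤ × ℤ × ℤ) :=
  {x | ∃ t : ℤ, 0 ≤ t ∧ x = (i - 1 - t, j - 1 - t, t)} ∩ {x | AMem n x}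

/-- An order ideal of `A_n`: a set of elements of `A_n` closed downward under `Ale`. -/
def IsAIdeal (n : ℕ) (I : Set (ℤ × ℤ × ℤ)) : Prop :=
  (∀ x ∈ I, AMem n x) ∧ ∀ p ∈ I, ∀ q, Ale n q p → q ∈ I

/-- The toggle `t_p` on order ideals of `A_n`: add `p` if `p` is a minimal element of
`A_n ∖ I`, remove `p` if `p` is a maximal element of `I`, otherwise do nothing. -/
noncomputable def Atoggle (n : ℕ) (p : ℤ × ℤ × ℤ) (I : Set (ℤ × ℤ × ℤ)) :
    Set (ℤ × ℤ × ℤ) :=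
  if AMem n p ∧ p ∉ I ∧ ∀ q, Alt n q p → q ∈ I then I ∪ {p}
  else if p ∈ I ∧ ∀ q, Alt n p q → q ∉ I then I \ {p}
  else I

/-- The height function matrix entry corresponding to an order ideal `I` of `A_n`:
`h a b = min(a+b, 2n-a-b) - 2·|I ∩ S_{a,b}|`. -/
noncomputable def heightAt (n : ℕ) (I : Set (ℤ × ℤ × ℤ)) (a b : ℤ) : ℤ :=
  min (a + b) (2 * (n : ℤ) - a - b) - 2 * (I ∩ Sij n a b).ncard

theorem Sij_finite (n : ℕ) (a b : ℤ) : (Sij n a b).Finite := by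
  apply ((Set.finite_Icc (0:ℤ) n).image (fun t => ((a - 1 - t, b - 1 - t, t) : ℤ × ℤ × ℤ))).subset
  rintro x ⟨⟨t, ht, rfl⟩, h1, h2, h3, h4⟩
  refine ⟨t, ⟨ht, ?_⟩, rfl⟩
  simp only at h1 h2 h3 h4
  omega

theorem Sij_inj {n : ℕ} {a b i j : ℤ} {p : ℤ × ℤ × ℤ} (h : p ∈ Sij n a b)
    (h' : p ∈ Sij n i j) : (a, b) = (i, j) := by
  obtain ⟨⟨t, ht, rfl⟩, -⟩ := h
  obtain ⟨⟨s, hs, e⟩, -⟩ := h'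
  simp only [Prod.mk.injEq] at e ⊢
  omega

/-- Let `n ≥ 2`, `I` an order ideal of `A_n`, `1 ≤ i,j ≤ n-1`, and `p ∈ S_{i,j}` with
`t_p(I) ≠ I`. Then the height function matrices `h`, `h'` corresponding to `I` and
`t_p(I)` agree in every entry except `(i,j)`, and `h'_{i,j} = h_{i,j} + 2` if `p ∈ I`
(`p` is toggled out of `I`) while `h'_{i,j} = h_{i,j} - 2` if `p ∉ I` (`p` is toggled
into `I`). -/
theorem stmt_18 (n : ℕ) (hn : 2 ≤ n) (I : Set (ℤ × ℤ × ℤ)) (hI : IsAIdeal n I)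
    (i j : ℤ) (hi1 : 1 ≤ i) (hi2 : i ≤ (n : ℤ) - 1) (hj1 : 1 ≤ j) (hj2 : j ≤ (n : ℤ) - 1)
    (p : ℤ × ℤ × ℤ) (hp : p ∈ Sij n i j) (hne : Atoggle n p I ≠ I) :
    (∀ a b : ℤ, 0 ≤ a → a ≤ (n : ℤ) → 0 ≤ b → b ≤ (n : ℤ) → (a, b) ≠ (i, j) →
      heightAt n (Atoggle n p I) a b = heightAt n I a b) ∧
    (p ∈ I → heightAt n (Atoggle n p I) i j = heightAt n I i j + 2) ∧
    (p ∉ I → heightAt n (Atoggle n p I) i j = heightAt n I i j - 2) := by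
  have hout : ∀ a b : ℤ, (a, b) ≠ (i, j) → p ∉ Sij n a b := fun a b hab h => hab (Sij_inj h hp)
  have hfin : (I ∩ Sij n i j).Finite := (Sij_finite n i j).inter_of_right I
  have key : (p ∉ I ∧ Atoggle n p I = I ∪ {p}) ∨ (p ∈ I ∧ Atoggle n p I = I \ {p}) := by
    unfold Atoggle at hne ⊢
    split_ifs at hne ⊢ with h1 h2
    · exact Or.inl ⟨h1.2.1, rfl⟩
    · exact Or.inr ⟨h2.1, rfl⟩
    · exact absurd rfl hne
  rcases key with ⟨hpI, e⟩ | ⟨hpI, e⟩ <;> rw [e]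
  · refine ⟨fun a b _ _ _ _ hab => ?_, fun h => absurd h hpI, fun _ => ?_⟩
    · have : (I ∪ {p}) ∩ Sij n a b = I ∩ Sij n a b := by
        ext x
        have := hout a b hab
        simp only [Set.mem_inter_iff, Set.mem_union, Set.mem_singleton_iff]
        constructor
        · rintro ⟨h | rfl, h'⟩
          · exact ⟨h, h'⟩
          · exact absurd h' this
        · rintro ⟨h, h'⟩
          exact ⟨Or.inl h, h'⟩
      unfold heightAt
      rw [this]
    · have : (I ∪ {p}) ∩ Sij n i j = insert p (I ∩ Sij n i j) := by
        ext x
        simp only [Set.mem_inter_iff, Set.mem_union, Set.mem_singleton_iff, Set.mem_insert_iff]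
        constructor
        · tauto
        · rintro (rfl | h)
          · exact ⟨Or.inr rfl, hp⟩
          · exact ⟨Or.inl h.1, h.2⟩
      unfold heightAt
      rw [this, Set.ncard_insert_of_notMem (fun h => hpI h.1) hfin]
      push_cast
      ring
  · refine ⟨fun a b _ _ _ _ hab => ?_, fun _ => ?_, fun h => absurd hpI h⟩
    · have : (I \ {p}) ∩ Sij n a b = I ∩ Sij n a b := by
        ext x
        have := hout a b hab
        simp only [Set.mem_inter_iff, Set.mem_diff, Set.mem_singleton_iff]
        constructor
        · tauto
        · rintro ⟨h, h'⟩
          exact ⟨⟨h, fun hx => this (hx ▸ h')⟩, h'⟩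
      unfold heightAt
      rw [this]
    · have : (I \ {p}) ∩ Sij n i j = (I ∩ Sij n i j) \ {p} := by
        ext x
        simp only [Set.mem_inter_iff, Set.mem_diff, Set.mem_singleton_iff]
        tauto
      have hc := Set.ncard_diff_singleton_add_one (s := I ∩ Sij n i j) ⟨hpI, hp⟩ hfin
      unfold heightAt
      rw [this, ← hc]
      push_cast
      ring
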